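/- For every real a ≥ 1 and every ε > 0 there exists k_0 such that for all k ≥ k_0: every k-uniform hypergraph H with maximum degree at most k^a admits an equitable strong coloring with at least (1-ε)·k/(a ln k) parts; i.e., ec(H) ≥ (1 - o_k(1))·k/(a ln k). -/

import Mathlib

open Finset Real

/-- `P` is a strong `r`-coloring of the hypergraph `H`. -/
def IsStrongColoring {V : Type} [Fintype V] [DecidableEq V]
    (H : Finset (Finset V)) (r : ℕ) (P : Fin r → Finset V) : Prop :=
  (∀ i j, i ≠ j → Disjoint (P i) (P j)) ∧
  (Finset.univ.biUnion P = (Finset.univ : Finset V)) ∧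
  (∀ e ∈ H, ∀ i, (e ∩ P i).Nonempty)

/-- The partition is equitable: each part has size `⌈n/r⌉` or `⌊n/r⌋`. -/
def IsEquitable {V : Type} [Fintype V] (r : ℕ) (P : Fin r → Finset V) : Prop :=
  ∀ i, (P i).card = Fintype.card V / r ∨ (P i).card = (Fintype.card V + r - 1) / r

/-- The sample points that lie in none of the events `A j` with `j ∈ S`. -/
def avoiding {Ω ι : Type*} [Fintype Ω] [DecidableEq Ω] (A : ι → Finset Ω) (S : Finset ι) :
    Finset Ω :=
  univ.filter fun ω => ∀ j ∈ S, ω ∉ A j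

theorem card_avoiding_le_add_sum {Ω ι : Type*} [Fintype Ω] [DecidableEq Ω] [DecidableEq ι]
    (A : ι → Finset Ω) (S T : Finset ι) :
    #(avoiding A T) ≤ #(avoiding A (S ∪ T)) + ∑ j ∈ S, #(A j ∩ avoiding A T) := by
  have h : avoiding A T ⊆ avoiding A (S ∪ T) ∪ S.biUnion fun j => A j ∩ avoiding A T := by
    intro ω hω
    by_cases hS : ∀ j ∈ S, ω ∉ A j
    · refine mem_union_left _ ?_
      simp only [avoiding, mem_filter, mem_univ, true_and, mem_union] at hω ⊢
      rintro j (hj | hj)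
      exacts [hS j hj, hω j hj]
    · push Not at hS
      obtain ⟨j, hj, hjω⟩ := hS
      exact mem_union_right _ (mem_biUnion.2 ⟨j, hj, mem_inter.2 ⟨hjω, hω⟩⟩)
  calc #(avoiding A T) ≤ _ := card_le_card h
    _ ≤ _ := card_union_le _ _
    _ ≤ _ := by gcongr; exact card_biUnion_le

/-- The inductive bound in the symmetric Lovász local lemma. -/
theorem card_inter_avoiding_le {Ω ι : Type*} [Fintype Ω] [DecidableEq Ω] [DecidableEq ι]
    (A : ι → Finset Ω) (N : ι → Finset ι) (p d : ℝ) (hp : 0 ≤ p)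
    (hN : ∀ i, (#(N i) : ℝ) ≤ d) (hpd : 4 * p * d ≤ 1)
    (h : ∀ i (S : Finset ι), Disjoint S (N i) →
      (#(A i ∩ avoiding A S) : ℝ) ≤ p * #(avoiding A S)) (S : Finset ι) :
    ∀ i, (#(A i ∩ avoiding A S) : ℝ) ≤ 2 * p * #(avoiding A S) := by
  induction S using Finset.strongInduction with
  | H S ih =>
    intro i
    rcases (S ∩ N i).eq_empty_or_nonempty with h0 | h0
    · have := h i S (disjoint_iff_inter_eq_empty.2 h0)
      have : 0 ≤ p * #(avoiding A S) := by positivity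
      linarith
    · have hss : S \ N i ⊂ S := by
        refine ⟨sdiff_subset, fun hs => ?_⟩
        obtain ⟨j, hj⟩ := h0
        exact (mem_sdiff.1 (hs (mem_inter.1 hj).1)).2 (mem_inter.1 hj).2
      have hsub : (#(A i ∩ avoiding A S) : ℝ) ≤ #(A i ∩ avoiding A (S \ N i)) := by
        norm_cast
        refine card_le_card (inter_subset_inter_left fun ω hω => ?_)
        simp only [avoiding, mem_filter, mem_univ, true_and] at hω ⊢
        exact fun j hj => hω j (mem_sdiff.1 hj).1
      have h2 := h i (S \ N i) disjoint_sdiff_self_left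
      have hun : S ∩ N i ∪ S \ N i = S := by
        ext j; simp only [mem_union, mem_inter, mem_sdiff]; tauto
      have h3 := card_avoiding_le_add_sum A (S ∩ N i) (S \ N i)
      rw [hun] at h3
      have h3' : (#(avoiding A (S \ N i)) : ℝ) ≤
          #(avoiding A S) + ∑ j ∈ S ∩ N i, (#(A j ∩ avoiding A (S \ N i)) : ℝ) := by
        exact_mod_cast h3
      have h4 : ∑ j ∈ S ∩ N i, (#(A j ∩ avoiding A (S \ N i)) : ℝ) ≤
          d * (2 * p * #(avoiding A (S \ N i))) := by
        calc _ ≤ ∑ j ∈ S ∩ N i, 2 * p * (#(avoiding A (S \ N i)) : ℝ) :=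
              sum_le_sum fun j _ => ih _ hss j
          _ = #(S ∩ N i) * (2 * p * #(avoiding A (S \ N i))) := by
              rw [sum_const, nsmul_eq_mul]
          _ ≤ _ := by
              gcongr
              exact le_trans (by exact_mod_cast card_le_card inter_subset_right) (hN i)
      have h5 : (0 : ℝ) ≤ #(avoiding A (S \ N i)) := by positivity
      have h6 : (#(avoiding A (S \ N i)) : ℝ) ≤ 2 * #(avoiding A S) := by nlinarith
      nlinarith

/-- The symmetric **Lovász local lemma** for the uniform measure on a finite type. -/
theorem exists_forall_notMem_of_local {Ω ι : Type*} [Fintype Ω] [Nonempty Ω] [DecidableEq Ω]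
    [Fintype ι] [DecidableEq ι] (A : ι → Finset Ω) (N : ι → Finset ι) (p d : ℝ) (hp : 0 ≤ p)
    (hd : 1 ≤ d) (hN : ∀ i, (#(N i) : ℝ) ≤ d) (hpd : 4 * p * d ≤ 1)
    (h : ∀ i (S : Finset ι), Disjoint S (N i) →
      (#(A i ∩ avoiding A S) : ℝ) ≤ p * #(avoiding A S)) :
    ∃ ω, ∀ i, ω ∉ A i := by
  have key : ∀ S : Finset ι, 0 < #(avoiding A S) := by
    intro S
    induction S using Finset.induction_on with
    | empty => simp [avoiding, Fintype.card_pos]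
    | insert i S _ ih =>
      have h1 := card_inter_avoiding_le A N p d hp hN hpd h S i
      have h2 := card_avoiding_le_add_sum A {i} S
      rw [sum_singleton, singleton_union] at h2
      have h2' : (#(avoiding A S) : ℝ) ≤
          #(avoiding A (insert i S)) + #(A i ∩ avoiding A S) := by exact_mod_cast h2
      have ih' : (0 : ℝ) < #(avoiding A S) := by exact_mod_cast ih
      have h3 : 4 * p ≤ 1 := by nlinarith
      have : (0 : ℝ) < #(avoiding A (insert i S)) := by nlinarith
      exact_mod_cast this
  obtain ⟨ω, hω⟩ := card_pos.1 (key univ)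
  simp only [avoiding, mem_filter, mem_univ, true_and, forall_const] at hω
  exact ⟨ω, hω⟩

/-- Events on a product space depending on disjoint sets of coordinates are independent. -/
theorem card_inter_mul_card_of_dependsOn {G K : Type*} [Fintype G] [DecidableEq G] [Fintype K]
    [DecidableEq K] (T : Finset G) (A B : Finset (G → K))
    (hA : ∀ ω ω', (∀ g ∈ T, ω g = ω' g) → ω ∈ A → ω' ∈ A)
    (hB : ∀ ω ω', (∀ g, g ∉ T → ω g = ω' g) → ω ∈ B → ω' ∈ B) :
    #(A ∩ B) * Fintype.card (G → K) = #A * #B := by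
  rw [← card_univ, ← card_product, ← card_product]
  refine card_bij' (fun z _ => (T.piecewise z.1 z.2, T.piecewise z.2 z.1))
    (fun z _ => (T.piecewise z.1 z.2, T.piecewise z.2 z.1)) ?_ ?_ ?_ ?_
  · rintro ⟨ω, ω'⟩ hz
    simp only [mem_product, mem_inter, mem_univ, and_true] at hz ⊢
    exact ⟨hA _ _ (fun g hg => by simp [hg]) hz.1, hB _ _ (fun g hg => by simp [hg]) hz.2⟩
  · rintro ⟨ω, ω'⟩ hz
    simp only [mem_product, mem_inter, mem_univ, and_true] at hz ⊢
    exact ⟨hA _ _ (fun g hg => by simp [hg]) hz.1, hB _ _ (fun g hg => by simp [hg]) hz.2⟩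
  · rintro ⟨ω, ω'⟩ _
    ext g <;> by_cases hg : g ∈ T <;> simp [hg]
  · rintro ⟨ω, ω'⟩ _
    ext g <;> by_cases hg : g ∈ T <;> simp [hg]

/-- Exponential moment bound for the size of a colour class inside `e`, where the vertices in each
fibre of `g` receive distinct colours through a uniformly random cyclic shift. -/
theorem sum_pow_card_shift_le {V G : Type*} [Fintype G] [DecidableEq G] {m : ℕ} [NeZero m]
    (g : V → G) (pos : V → ZMod m) (e : Finset V)
    (hinj : Set.InjOn (fun v => (g v, pos v)) e) (x : ℝ) (hx0 : 0 ≤ x)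
    (i : ZMod m) :
    ∑ ω : G → ZMod m, x ^ #{v ∈ e | pos v + ω (g v) = i} ≤
      Fintype.card (G → ZMod m) * exp (-((1 - x) * #e / m)) := by
  have hm : (0 : ℝ) < m := by exact_mod_cast Nat.pos_of_ne_zero (NeZero.ne m)
  have h1 : ∀ ω : G → ZMod m, x ^ #{v ∈ e | pos v + ω (g v) = i} =
      ∏ c, x ^ #{v ∈ e | g v = c ∧ pos v + ω c = i} := by
    intro ω
    rw [prod_pow_eq_pow_sum, card_eq_sum_card_fiberwise (f := g) (t := univ) (by simp)]
    congr 1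
    refine sum_congr rfl fun c _ => ?_
    rw [filter_filter]
    congr 1
    ext v
    simp only [mem_filter]
    constructor
    · rintro ⟨h, h', rfl⟩; exact ⟨h, rfl, h'⟩
    · rintro ⟨h, rfl, h'⟩; exact ⟨h, h', rfl⟩
  have h2 : ∀ (c : G) (y : ZMod m), x ^ #{v ∈ e | g v = c ∧ pos v + y = i} =
      1 - (1 - x) * #{v ∈ e | g v = c ∧ pos v + y = i} := by
    intro c y
    have : #{v ∈ e | g v = c ∧ pos v + y = i} ≤ 1 := by
      refine card_le_one.2 fun u hu v hv => ?_
      simp only [mem_filter] at hu hv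
      refine hinj hu.1 hv.1 (Prod.ext (hu.2.1.trans hv.2.1.symm) ?_)
      exact add_right_cancel (hu.2.2.trans hv.2.2.symm)
    interval_cases h : #{v ∈ e | g v = c ∧ pos v + y = i} <;> simp
  have h3 : ∀ c : G, ∑ y : ZMod m, (#{v ∈ e | g v = c ∧ pos v + y = i} : ℝ) =
      #{v ∈ e | g v = c} := by
    intro c
    rw [card_eq_sum_card_fiberwise (f := fun v => i - pos v) (t := univ) (by simp)]
    push_cast
    refine sum_congr rfl fun y _ => ?_
    rw [filter_filter]
    congr 2
    ext v
    simp only [mem_filter, sub_eq_iff_eq_add']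
    exact ⟨fun h => ⟨h.1, h.2.1, h.2.2.symm⟩, fun h => ⟨h.1, h.2.1, h.2.2.symm⟩⟩
  have h4 : ∀ c : G, ∑ y : ZMod m, x ^ #{v ∈ e | g v = c ∧ pos v + y = i} ≤
      m * exp (-((1 - x) * #{v ∈ e | g v = c} / m)) := by
    intro c
    simp_rw [h2]
    rw [sum_sub_distrib, ← mul_sum, h3]
    simp only [sum_const, card_univ, ZMod.card, nsmul_eq_mul, mul_one]
    have := add_one_le_exp (-((1 - x) * #{v ∈ e | g v = c} / m))
    calc (m : ℝ) - (1 - x) * #{v ∈ e | g v = c}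
        = m * (-((1 - x) * #{v ∈ e | g v = c} / m) + 1) := by field_simp; ring
      _ ≤ _ := by gcongr
  simp_rw [h1]
  rw [← Fintype.prod_sum (fun (c : G) (y : ZMod m) => x ^ #{v ∈ e | g v = c ∧ pos v + y = i})]
  calc _ ≤ ∏ c : G, (m * exp (-((1 - x) * #{v ∈ e | g v = c} / m)) : ℝ) :=
        prod_le_prod (fun c _ => sum_nonneg fun y _ => by positivity) fun c _ => h4 c
    _ = _ := by
        rw [prod_mul_distrib, ← exp_sum, sum_neg_distrib, ← sum_div, ← mul_sum,
          card_eq_sum_card_fiberwise (f := g) (s := e) (t := univ) (by simp)]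
        simp [ZMod.card]

/-- Fewer than `c + 1` vertices of `e` receive the colour `y` with probability at most `q`. -/
theorem card_filter_card_shift_le {V G : Type*} [Fintype G] [DecidableEq G] {m : ℕ} [NeZero m]
    (g : V → G) (pos : V → ZMod m) (e : Finset V)
    (hinj : Set.InjOn (fun v => (g v, pos v)) e) (x q : ℝ) (c : ℕ) (hx0 : 0 ≤ x) (hx1 : x ≤ 1)
    (hxc : 0 < x ^ c) (hq : exp (-((1 - x) * #e / m)) ≤ q * x ^ c) (y : ZMod m) :
    (#{ω : G → ZMod m | #{v ∈ e | pos v + ω (g v) = y} ≤ c} : ℝ) ≤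
      q * Fintype.card (G → ZMod m) := by
  have h1 := sum_pow_card_shift_le g pos e hinj x hx0 y
  have h2 : (#{ω : G → ZMod m | #{v ∈ e | pos v + ω (g v) = y} ≤ c} : ℝ) * x ^ c ≤
      ∑ ω : G → ZMod m, x ^ #{v ∈ e | pos v + ω (g v) = y} := by
    calc _ = ∑ ω : G → ZMod m with #{v ∈ e | pos v + ω (g v) = y} ≤ c, x ^ c := by
          rw [sum_const, nsmul_eq_mul]
      _ ≤ ∑ ω : G → ZMod m with #{v ∈ e | pos v + ω (g v) = y} ≤ c,
            x ^ #{v ∈ e | pos v + ω (g v) = y} :=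
          sum_le_sum fun ω hω => pow_le_pow_of_le_one hx0 hx1 (mem_filter.1 hω).2
      _ ≤ _ := sum_le_sum_of_subset_of_nonneg (filter_subset _ _) fun _ _ _ => by positivity
  refine le_of_mul_le_mul_right ?_ hxc
  calc _ ≤ _ := h2.trans h1
    _ ≤ Fintype.card (G → ZMod m) * (q * x ^ c) := by gcongr
    _ = _ := by ring

theorem exists_enumeration {V : Type*} (W : Finset V) :
    ∃ idx : V → ℕ, Set.InjOn idx W ∧ (∀ v ∈ W, idx v < #W) ∧ ∀ t < #W, ∃ v ∈ W, idx v = t := by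
  classical
  refine ⟨fun v => if h : v ∈ W then W.equivFin ⟨v, h⟩ else 0, ?_, ?_, ?_⟩
  · intro u hu v hv huv
    simp only [mem_coe] at hu hv
    simpa [hu, hv, Fin.val_inj] using huv
  · intro v hv
    simp [hv]
  · intro t ht
    exact ⟨W.equivFin.symm ⟨t, ht⟩, coe_mem _, by simp⟩

theorem injOn_div_natCast {V : Type*} {m : ℕ} (W : Finset V) (idx : V → ℕ)
    (hinj : Set.InjOn idx W) : Set.InjOn (fun v => (idx v / m, (idx v : ZMod m))) W := by
  intro u hu v hv huv
  obtain ⟨h1, h2⟩ := Prod.mk.inj huv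
  rw [ZMod.natCast_eq_natCast_iff'] at h2
  refine hinj hu hv ?_
  rw [← Nat.div_add_mod (idx u) m, ← Nat.div_add_mod (idx v) m, h1, h2]

/-- Cyclically shifting the colours inside consecutive blocks of length `m` gives classes of
almost equal size. -/
theorem card_shift_class_bounds {V : Type*} {m : ℕ} [NeZero m] (W : Finset V) (idx : V → ℕ)
    (hinj : Set.InjOn idx W) (hlt : ∀ v ∈ W, idx v < #W) (hsurj : ∀ t < #W, ∃ v ∈ W, idx v = t)
    (σ : ℕ → ZMod m) (y : ZMod m) :
    #W / m ≤ #{v ∈ W | (idx v : ZMod m) + σ (idx v / m) = y} ∧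
      #{v ∈ W | (idx v : ZMod m) + σ (idx v / m) = y} ≤ (#W + m - 1) / m := by
  have hm : 0 < m := Nat.pos_of_ne_zero (NeZero.ne m)
  constructor
  · conv_lhs => rw [← card_range (#W / m)]
    refine card_le_card_of_surjOn (fun v => idx v / m) fun t ht => ?_
    simp only [coe_range, Set.mem_Iio] at ht
    have hr := ZMod.val_lt (y - σ t)
    obtain ⟨v, hv, hvt⟩ := hsurj (m * t + (y - σ t).val) (by
      have := Nat.div_mul_le_self (#W) m
      nlinarith)
    have hdiv : idx v / m = t := by
      rw [hvt, Nat.mul_add_div hm, Nat.div_eq_of_lt hr, add_zero]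
    refine ⟨v, ?_, hdiv⟩
    simp only [coe_filter, Set.mem_ofPred_eq]
    refine ⟨hv, ?_⟩
    rw [hdiv, hvt]
    simp
  · conv_rhs => rw [← card_range ((#W + m - 1) / m)]
    refine card_le_card_of_injOn (fun v => idx v / m) (fun v hv => ?_) fun u hu v hv huv => ?_
    · simp only [coe_filter, Set.mem_ofPred_eq] at hv
      have := hlt v hv.1
      simp only [coe_range, Set.mem_Iio]
      calc idx v / m < (idx v + m) / m := by rw [Nat.add_div_right _ hm]; omega
        _ ≤ _ := Nat.div_le_div_right (by omega)
    · simp only [coe_filter, Set.mem_ofPred_eq] at hu hv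
      refine injOn_div_natCast (m := m) W idx hinj hu.1 hv.1 (Prod.ext huv ?_)
      have h := hu.2.trans hv.2.symm
      simp only at huv
      rw [huv] at h
      exact add_right_cancel h

/-- A hypergraph has a balanced colouring in which every colour occurs more than `c` times in every
edge, as soon as the local lemma applies to cyclic shifts of blocks. -/
theorem exists_balanced_coloring {V ι : Type*} [DecidableEq V] [Fintype ι] (W : Finset V)
    (E : ι → Finset V) (m s c : ℕ) [NeZero m] (hEW : ∀ i, E i ⊆ W) (hs : ∀ i, #(E i) = s)
    (hs1 : 1 ≤ s) (Δ : ℝ) (hΔ : 1 ≤ Δ) (hdeg : ∀ v, (#{i | v ∈ E i} : ℝ) ≤ Δ) (x q : ℝ)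
    (hx0 : 0 ≤ x) (hx1 : x ≤ 1) (hxc : 0 < x ^ c)
    (hq : exp (-((1 - x) * s / m)) ≤ q * x ^ c) (hL : 4 * (m * q) * (s * m * Δ) ≤ 1) :
    ∃ f : V → ZMod m,
      (∀ y, #W / m ≤ #{v ∈ W | f v = y} ∧ #{v ∈ W | f v = y} ≤ (#W + m - 1) / m) ∧
      ∀ i y, c < #{v ∈ E i | f v = y} := by
  classical
  have hm : 0 < m := Nat.pos_of_ne_zero (NeZero.ne m)
  have hm1 : (1 : ℝ) ≤ m := by exact_mod_cast hm
  have hs1' : (1 : ℝ) ≤ s := by exact_mod_cast hs1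
  have hq0 : 0 ≤ q := by
    by_contra! h
    nlinarith [exp_pos (-((1 - x) * s / m))]
  obtain ⟨idx, hinj, hlt, hsurj⟩ := exists_enumeration W
  let g : V → Fin (#W + 1) := fun v => Fin.ofNat (#W + 1) (idx v / m)
  have hg : ∀ u ∈ W, ∀ v ∈ W, g u = g v → idx u / m = idx v / m := by
    have hval : ∀ v ∈ W, (g v : ℕ) = idx v / m := fun v hv =>
      Nat.mod_eq_of_lt (by have := hlt v hv; have := Nat.div_le_self (idx v) m; omega)
    intro u hu v hv huv
    rw [← hval u hu, ← hval v hv, huv]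
  have hgW : Set.InjOn (fun v => (g v, (idx v : ZMod m))) W := by
    intro u hu v hv huv
    obtain ⟨h1, h2⟩ := Prod.mk.inj huv
    exact injOn_div_natCast (m := m) W idx hinj hu hv (Prod.ext (hg u hu v hv h1) h2)
  let A : ι → Finset (Fin (#W + 1) → ZMod m) := fun i =>
    {ω | ∃ y, #{v ∈ E i | (idx v : ZMod m) + ω (g v) = y} ≤ c}
  let N : ι → Finset ι := fun i => {j | ∃ u ∈ E i, ∃ v ∈ E j, g u = g v}
  have hA : ∀ i, (#(A i) : ℝ) ≤ m * q * Fintype.card (Fin (#W + 1) → ZMod m) := by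
    intro i
    have h1 : A i ⊆ univ.biUnion fun y => {ω | #{v ∈ E i | (idx v : ZMod m) + ω (g v) = y} ≤ c} := by
      intro ω hω
      simpa [A] using hω
    calc (#(A i) : ℝ) ≤
          ∑ y : ZMod m, (#{ω : Fin (#W + 1) → ZMod m |
            #{v ∈ E i | (idx v : ZMod m) + ω (g v) = y} ≤ c} : ℝ) := by
          exact_mod_cast (card_le_card h1).trans card_biUnion_le
      _ ≤ ∑ y : ZMod m, q * Fintype.card (Fin (#W + 1) → ZMod m) :=
          sum_le_sum fun y _ => card_filter_card_shift_le g _ (E i)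
            (hgW.mono (coe_subset.2 (hEW i))) x q c hx0 hx1 hxc (by rw [hs]; exact hq) y
      _ = _ := by rw [sum_const, card_univ, ZMod.card, nsmul_eq_mul, mul_assoc]
  have hN : ∀ i, (#(N i) : ℝ) ≤ s * m * Δ := by
    intro i
    have h1 : N i ⊆ (E i).biUnion fun u => {v ∈ W | g u = g v}.biUnion fun v => {j | v ∈ E j} := by
      intro j hj
      simp only [N, mem_filter, mem_univ, true_and] at hj
      obtain ⟨u, hu, v, hv, huv⟩ := hj
      simp only [mem_biUnion, mem_filter, mem_univ, true_and]
      exact ⟨u, hu, v, ⟨hEW j hv, huv⟩, hv⟩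
    have h2 : ∀ u, #{v ∈ W | g u = g v} ≤ m := by
      intro u
      rw [← ZMod.card m, ← card_univ]
      refine card_le_card_of_injOn (fun v => (idx v : ZMod m)) (by simp) ?_
      intro v hv w hw hvw
      simp only [coe_filter, Set.mem_ofPred_eq] at hv hw
      exact hgW hv.1 hw.1 (Prod.ext (hv.2.symm.trans hw.2) hvw)
    calc (#(N i) : ℝ) ≤ ∑ u ∈ E i, ∑ v ∈ W with g u = g v, (#{j | v ∈ E j} : ℝ) := by
          have := (card_le_card h1).trans (card_biUnion_le.trans
            (sum_le_sum fun u _ => card_biUnion_le))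
          exact_mod_cast this
      _ ≤ ∑ u ∈ E i, ∑ v ∈ W with g u = g v, Δ :=
          sum_le_sum fun u _ => sum_le_sum fun v _ => hdeg v
      _ ≤ ∑ u ∈ E i, m * Δ := by
          refine sum_le_sum fun u _ => ?_
          rw [sum_const, nsmul_eq_mul]
          gcongr
          exact h2 u
      _ = _ := by rw [sum_const, hs, nsmul_eq_mul]; ring
  have hloc : ∀ i (S : Finset ι), Disjoint S (N i) →
      (#(A i ∩ avoiding A S) : ℝ) ≤ m * q * #(avoiding A S) := by
    intro i S hS
    have hcard := card_inter_mul_card_of_dependsOn ((E i).image g) (A i) (avoiding A S)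
      (by
        intro ω ω' hω h
        simp only [A, mem_filter, mem_univ, true_and] at h ⊢
        obtain ⟨y, hy⟩ := h
        refine ⟨y, ?_⟩
        rwa [← filter_congr (s := E i) (p := fun v => (idx v : ZMod m) + ω (g v) = y)
          fun v hv => by rw [hω _ (mem_image_of_mem g hv)]])
      (by
        intro ω ω' hω h
        simp only [avoiding, A, mem_filter, mem_univ, true_and, not_exists] at h ⊢
        intro j hj y
        have hjN := disjoint_left.1 hS hj
        simp only [N, mem_filter, mem_univ, true_and, not_exists, not_and] at hjN
        have hv : ∀ v ∈ E j, ω (g v) = ω' (g v) := fun v hv => hω _ fun hgv => by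
          obtain ⟨u, hu, huv⟩ := mem_image.1 hgv
          exact hjN u hu v hv huv
        rw [← filter_congr (s := E j) (p := fun v => (idx v : ZMod m) + ω (g v) = y)
          fun v hvj => by rw [hv v hvj]]
        exact h j hj y)
    have hcard' : (#(A i ∩ avoiding A S) : ℝ) * Fintype.card (Fin (#W + 1) → ZMod m) =
        #(A i) * #(avoiding A S) := by exact_mod_cast hcard
    have hpos : (0 : ℝ) < Fintype.card (Fin (#W + 1) → ZMod m) := by
      exact_mod_cast Fintype.card_pos
    refine le_of_mul_le_mul_right ?_ hpos
    rw [hcard']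
    calc _ ≤ m * q * Fintype.card (Fin (#W + 1) → ZMod m) * (#(avoiding A S) : ℝ) := by
          gcongr; exact hA i
      _ = _ := by ring
  have hd : 1 ≤ s * m * Δ := by
    have : 1 ≤ (s * m : ℝ) := one_le_mul_of_one_le_of_one_le hs1' hm1
    exact one_le_mul_of_one_le_of_one_le this hΔ
  obtain ⟨ω, hω⟩ := exists_forall_notMem_of_local A N (m * q) (s * m * Δ) (by positivity) hd hN hL
    hloc
  refine ⟨fun v => (idx v : ZMod m) + ω (g v), fun y => ?_, fun i y => ?_⟩
  · exact card_shift_class_bounds W idx hinj hlt hsurj (fun t => ω (Fin.ofNat (#W + 1) t)) y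
  · have := hω i
    simp only [A, mem_filter, mem_univ, true_and, not_exists, not_le] at this
    exact this y

/-- Refining a balanced colouring by balanced colourings of its classes gives a balanced one. -/
theorem eq_div_or_eq_ceil_div_of_refine {n m r b d : ℕ} (hm : 0 < m) (hr : 0 < r)
    (hb1 : n / m ≤ b) (hb2 : b ≤ (n + m - 1) / m) (hd1 : b / r ≤ d)
    (hd2 : d ≤ (b + r - 1) / r) : d = n / (m * r) ∨ d = (n + m * r - 1) / (m * r) := by
  have hmr : 0 < m * r := Nat.mul_pos hm hr
  have h1 : n / (m * r) ≤ d := by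
    rw [← Nat.div_div_eq_div_mul]
    exact (Nat.div_le_div_right hb1).trans hd1
  have h2 : d ≤ (n + m * r - 1) / (m * r) := by
    rw [← Nat.div_div_eq_div_mul]
    refine hd2.trans (Nat.div_le_div_right ?_)
    have h3 : (n + m * r - 1) / m = (n + m - 1) / m + (r - 1) := by
      rw [← Nat.add_mul_div_left _ _ hm]
      congr 1
      obtain ⟨r, rfl⟩ : ∃ t, r = t + 1 := ⟨r - 1, by omega⟩
      rw [Nat.mul_add, Nat.add_sub_cancel]
      omega
    omega
  have h4 : (n + m * r - 1) / (m * r) ≤ n / (m * r) + 1 := by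
    rw [← Nat.add_div_right _ hmr]
    exact Nat.div_le_div_right (by omega)
  omega

/-- Splitting the vertices into `m` balanced classes that meet every edge in more than `c` vertices,
and then colouring each class with `r` colours, gives an equitable strong colouring. -/
theorem exists_equitable_strongColoring_mul {V : Type} [Fintype V] [DecidableEq V]
    (H : Finset (Finset V)) (k m r c : ℕ) [NeZero m] [NeZero r] (hk : ∀ e ∈ H, #e = k)
    (hk1 : 1 ≤ k) (Δ : ℝ) (hΔ : 1 ≤ Δ) (hdeg : ∀ v, (#{e ∈ H | v ∈ e} : ℝ) ≤ Δ)
    (x q : ℝ) (hx0 : 0 < x) (hx1 : x ≤ 1) (hq : exp (-((1 - x) * k / m)) ≤ q * x ^ c)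
    (hL : 4 * (m * q) * (k * m * Δ) ≤ 1)
    (hL' : 4 * (r * exp (-((c + 1 : ℕ) / r))) * ((c + 1 : ℕ) * r * Δ) ≤ 1) :
    ∃ P : Fin (m * r) → Finset V, IsStrongColoring H (m * r) P ∧ IsEquitable (m * r) P := by
  have hdegH : ∀ v, #{i : H | v ∈ i.1} ≤ #{e ∈ H | v ∈ e} := fun v =>
    card_le_card_of_injOn Subtype.val (fun i hi => by
      simp only [coe_filter, mem_univ, true_and, Set.mem_ofPred_eq] at hi ⊢
      exact ⟨i.2, hi⟩) Subtype.val_injective.injOn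
  obtain ⟨f, hf1, hf2⟩ := exists_balanced_coloring (univ : Finset V) (fun e : H => e.1) m k c
    (fun _ => subset_univ _) (fun e => hk _ e.2) hk1 Δ hΔ
    (fun v => le_trans (by exact_mod_cast hdegH v) (hdeg v)) x q hx0.le hx1 (by positivity) hq hL
  choose E hE1 hE2 using fun (y : ZMod m) (e : H) => exists_subset_card_eq (hf2 e y)
  have hex : ∀ y : ZMod m, ∃ f' : V → ZMod r,
      (∀ z, #{v | f v = y} / r ≤ #{v ∈ ({v | f v = y} : Finset V) | f' v = z} ∧
        #{v ∈ ({v | f v = y} : Finset V) | f' v = z} ≤ (#{v | f v = y} + r - 1) / r) ∧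
      ∀ (i : H) z, 0 < #{v ∈ E y i | f' v = z} := fun y =>
    exists_balanced_coloring _ (E y) r (c + 1) 0
      (fun e v hv => mem_filter.2 ⟨mem_univ _, (mem_filter.1 (hE1 y e hv)).2⟩)
      (fun e => hE2 y e) (by omega) Δ hΔ
      (fun v => le_trans (by
        have : #{i : H | v ∈ E y i} ≤ #{i : H | v ∈ i.1} :=
          card_le_card fun i hi => by
            simp only [mem_filter, mem_univ, true_and] at hi ⊢
            exact (mem_filter.1 (hE1 y i hi)).1
        exact_mod_cast this.trans (hdegH v)) (hdeg v))
      0 (exp (-((c + 1 : ℕ) / r))) le_rfl zero_le_one (by simp) (by simp) hL'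
  choose f' hf'1 hf'2 using hex
  let φ : ZMod m × ZMod r ≃ Fin (m * r) := Fintype.equivFinOfCardEq (by simp [ZMod.card])
  refine ⟨fun i => {v | φ (f v, f' (f v) v) = i}, ⟨?_, ?_, ?_⟩, ?_⟩
  · intro i j hij
    rw [disjoint_left]
    intro v hi hj
    simp only [mem_filter, mem_univ, true_and] at hi hj
    exact hij (hi.symm.trans hj)
  · ext v
    simp
  · intro e he i
    obtain ⟨⟨y, z⟩, rfl⟩ := φ.surjective i
    obtain ⟨v, hv⟩ := card_pos.1 (hf'2 y ⟨e, he⟩ z)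
    obtain ⟨hv1, hv2⟩ := mem_filter.1 hv
    obtain ⟨hv3, hv4⟩ := mem_filter.1 (hE1 y ⟨e, he⟩ hv1)
    refine ⟨v, mem_inter.2 ⟨hv3, ?_⟩⟩
    simp [hv4, hv2]
  · intro i
    obtain ⟨⟨y, z⟩, rfl⟩ := φ.surjective i
    have hP : ({v | φ (f v, f' (f v) v) = φ (y, z)} : Finset V) =
        {v ∈ ({v | f v = y} : Finset V) | f' y v = z} := by
      ext v
      simp only [mem_filter, mem_univ, true_and, φ.injective.eq_iff, Prod.mk.injEq]
      constructor
      · rintro ⟨rfl, h⟩; exact ⟨rfl, h⟩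
      · rintro ⟨rfl, h⟩; exact ⟨rfl, h⟩
    have h1 := hf1 y
    rw [card_univ] at h1
    simp only [hP]
    exact eq_div_or_eq_ceil_div_of_refine (Nat.pos_of_ne_zero (NeZero.ne m))
      (Nat.pos_of_ne_zero (NeZero.ne r)) h1.1 h1.2 (hf'1 y z).1 (hf'1 y z).2

theorem add_one_sub_mul_log_one_sub_pos {δ : ℝ} (h0 : 0 < δ) (h1 : δ < 1) :
    0 < δ + (1 - δ) * log (1 - δ) := by
  have h := log_lt_sub_one_of_pos (x := (1 - δ)⁻¹) (by simp [h1]) (by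
    rw [ne_eq, inv_eq_one]; linarith)
  rw [log_inv] at h
  have h2 : (1 - δ) * (1 - δ)⁻¹ = 1 := mul_inv_cancel₀ (by linarith)
  nlinarith

theorem eventually_large_log (ε B : ℝ) (hε : 0 < ε) :
    ∀ᶠ k : ℕ in Filter.atTop, B ≤ log k ∧ 2 * log k ^ 2 ≤ k ∧
      108 * log k ^ 6 ≤ exp (ε * log k) := by
  have hlog : Filter.Tendsto (fun k : ℕ => log (k : ℝ)) Filter.atTop Filter.atTop :=
    tendsto_log_atTop.comp tendsto_natCast_atTop_atTop
  have hpow : ∀ (b C : ℝ) (j : ℕ), 0 < b → ∀ᶠ y : ℝ in Filter.atTop, C * y ^ j ≤ exp (b * y) := by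
    intro b C j hb
    have h := (isLittleO_pow_exp_pos_mul_atTop j hb).bound (c := (|C| + 1)⁻¹) (by positivity)
    filter_upwards [h, Filter.eventually_ge_atTop 0] with y hy hy0
    rw [norm_of_nonneg (by positivity), norm_of_nonneg (by positivity),
      inv_mul_eq_div, le_div_iff₀ (by positivity)] at hy
    have : 0 ≤ y ^ j := by positivity
    nlinarith [le_abs_self C]
  filter_upwards [hlog.eventually_ge_atTop B, hlog.eventually (hpow 1 2 2 one_pos),
    hlog.eventually (hpow ε 108 6 hε), Filter.eventually_gt_atTop 0] with k h1 h2 h3 h4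
  rw [one_mul, exp_log (by exact_mod_cast h4)] at h2
  exact ⟨h1, h2, h3⟩

set_option maxHeartbeats 1000000 in
/-- The numerical conditions under which both splitting steps succeed, with `ℓ = log k`. -/
theorem exists_splitting_parameters {a δ ℓ : ℝ} {k : ℕ} (ha : 1 ≤ a) (hδ0 : 0 < δ)
    (hδ1 : δ ≤ 1 / 8) (hk : exp ℓ = k) (hℓ1 : 1 ≤ ℓ) (hℓa : a ≤ 2 * δ * ℓ)
    (hℓη : a + 5 ≤ (δ + (1 - δ) * log (1 - δ)) * ℓ) (hℓ2 : 2 * ℓ ^ 2 ≤ k)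
    (hℓ6 : 108 * ℓ ^ 6 ≤ exp (δ * ℓ)) :
    ∃ m r c : ℕ, ∃ q : ℝ, 0 < m ∧ 0 < r ∧ exp (-(δ * k / m)) ≤ q * (1 - δ) ^ c ∧
      4 * (m * q) * (k * m * (k : ℝ) ^ a) ≤ 1 ∧
      4 * (r * exp (-((c + 1 : ℕ) / r))) * ((c + 1 : ℕ) * r * (k : ℝ) ^ a) ≤ 1 ∧
      (1 - 4 * δ) * k / (a * ℓ) ≤ m * r := by
  have hk0 : (0 : ℝ) < k := hk ▸ exp_pos ℓ
  have hℓ0 : 0 < ℓ := by linarith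
  have ha0 : 0 < a := by linarith
  have hka : (k : ℝ) ^ a = exp (a * ℓ) := by rw [← hk, ← exp_mul, mul_comm]
  obtain ⟨m, hm⟩ : ∃ m : ℕ, m = ⌊(k : ℝ) / ℓ ^ 2⌋₊ := ⟨_, rfl⟩
  have hm1 : (m : ℝ) ≤ k / ℓ ^ 2 := hm ▸ Nat.floor_le (by positivity)
  have hm2 : (k : ℝ) / ℓ ^ 2 < m + 1 := hm ▸ Nat.lt_floor_add_one _
  have hm3 : (2 : ℝ) ≤ k / ℓ ^ 2 := by rw [le_div_iff₀ (by positivity)]; exact hℓ2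
  have hm0 : (0 : ℝ) < m := by linarith
  have hmk : (m : ℝ) ≤ k := hm1.trans (div_le_self hk0.le (by nlinarith))
  have hμ1 : ℓ ^ 2 ≤ k / m := by
    rw [le_div_iff₀ hm0, mul_comm]; exact (le_div_iff₀ (by positivity)).1 hm1
  have hμ2 : (k : ℝ) / m ≤ 2 * ℓ ^ 2 := by
    have h : (k : ℝ) / ℓ ^ 2 ≤ 2 * m := by linarith
    rw [div_le_iff₀ (by positivity)] at h
    rw [div_le_iff₀ hm0]; linarith
  obtain ⟨c, hc⟩ : ∃ c : ℕ, c = ⌊(1 - δ) * ((k : ℝ) / m)⌋₊ := ⟨_, rfl⟩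
  have hμ0 : 0 < (k : ℝ) / m := by positivity
  have hc1 : (c : ℝ) ≤ (1 - δ) * (k / m) :=
    hc ▸ Nat.floor_le (mul_nonneg (by linarith) hμ0.le)
  have hc2 : (1 - δ) * ((k : ℝ) / m) < c + 1 := hc ▸ Nat.lt_floor_add_one _
  have hs3 : (c : ℝ) + 1 ≤ 3 * ℓ ^ 2 := by nlinarith
  have hb0 : 0 < (1 + δ) * a * ℓ := by positivity
  have hs0 : (0 : ℝ) < c + 1 := by positivity
  obtain ⟨r, hr⟩ : ∃ r : ℕ, r = ⌊((c : ℝ) + 1) / ((1 + δ) * a * ℓ)⌋₊ := ⟨_, rfl⟩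
  have hr1 : (r : ℝ) ≤ (c + 1) / ((1 + δ) * a * ℓ) := hr ▸ Nat.floor_le (by positivity)
  have hr2 : ((c : ℝ) + 1) / ((1 + δ) * a * ℓ) < r + 1 := hr ▸ Nat.lt_floor_add_one _
  have hr0 : 0 < r := by
    rw [hr, Nat.floor_pos, le_div_iff₀ hb0, one_mul]
    have h1 : (1 + δ) * a * ℓ ≤ (1 + δ) * (2 * δ * ℓ) * ℓ := by gcongr
    have h2 : (1 - δ) * ℓ ^ 2 ≤ (1 - δ) * (k / m) :=
      mul_le_mul_of_nonneg_left hμ1 (by linarith)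
    have h3 : (1 + δ) * (2 * δ) ≤ 1 - δ := by nlinarith
    nlinarith [mul_le_mul_of_nonneg_right h3 (sq_nonneg ℓ)]
  have hr0' : (0 : ℝ) < r := by exact_mod_cast hr0
  have hrs : (r : ℝ) ≤ c + 1 := by
    refine hr1.trans (div_le_self hs0.le ?_)
    have h1 : 1 ≤ a * ℓ := one_le_mul_of_one_le_of_one_le ha hℓ1
    nlinarith
  have hsr : (1 + δ) * a * ℓ ≤ (c + 1) / r := by
    rw [le_div_iff₀ hr0', mul_comm]; exact (le_div_iff₀ hb0).1 hr1
  have hx0 : 0 < 1 - δ := by linarith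
  have hxc : 0 < (1 - δ) ^ c := pow_pos hx0 c
  refine ⟨m, r, c, exp (-(δ * k / m)) / (1 - δ) ^ c, by exact_mod_cast hm0, hr0, ?_, ?_, ?_, ?_⟩
  · rw [div_mul_cancel₀ _ hxc.ne']
  · have hq : exp (-(δ * k / m)) / (1 - δ) ^ c ≤ exp (-((a + 5) * ℓ)) := by
      rw [div_le_iff₀ hxc]
      have hpow : (1 - δ) ^ c = exp (c * log (1 - δ)) := by
        rw [exp_nat_mul, exp_log hx0]
      rw [hpow, ← exp_add, exp_le_exp]
      have hlog : log (1 - δ) ≤ 0 := log_nonpos hx0.le (by linarith)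
      have h1 : (1 - δ) * (k / m) * log (1 - δ) ≤ c * log (1 - δ) :=
        mul_le_mul_of_nonpos_right hc1 hlog
      have hη : 0 ≤ δ + (1 - δ) * log (1 - δ) := (add_one_sub_mul_log_one_sub_pos hδ0 (by linarith)).le
      have h2 : (a + 5) * ℓ ≤ (δ + (1 - δ) * log (1 - δ)) * (k / m) := by
        calc (a + 5) * ℓ ≤ (δ + (1 - δ) * log (1 - δ)) * ℓ * ℓ := by gcongr
          _ = (δ + (1 - δ) * log (1 - δ)) * ℓ ^ 2 := by ring
          _ ≤ _ := by gcongr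
      rw [mul_div_assoc]
      linarith
    have h4 : 4 ≤ exp (2 * ℓ) := by
      have := add_one_le_exp ℓ
      rw [two_mul, exp_add]
      nlinarith
    calc _ ≤ 4 * (k * exp (-((a + 5) * ℓ))) * (k * k * (k : ℝ) ^ a) := by gcongr
      _ = 4 * exp (-(2 * ℓ)) := by
          rw [hka, ← hk]
          have : exp (-(2 * ℓ)) =
              exp ℓ * exp (-((a + 5) * ℓ)) * (exp ℓ * exp ℓ * exp (a * ℓ)) := by
            simp only [← exp_add]; congr 1; ring
          rw [this]; ring
      _ ≤ exp (2 * ℓ) * exp (-(2 * ℓ)) := by gcongr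
      _ = 1 := by rw [← exp_add]; simp
  · push_cast
    calc _ = 4 * ((c : ℝ) + 1) * r * r * (exp (-((c + 1) / r)) * (k : ℝ) ^ a) := by ring
      _ ≤ 4 * (3 * ℓ ^ 2) * (3 * ℓ ^ 2) * (3 * ℓ ^ 2) * exp (-(δ * ℓ)) := by
          gcongr
          · exact hrs.trans hs3
          · exact hrs.trans hs3
          · rw [hka, ← exp_add, exp_le_exp]
            have : δ * ℓ ≤ δ * (a * ℓ) := by
              have : ℓ ≤ a * ℓ := le_mul_of_one_le_left hℓ0.le ha
              gcongr
            linarith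
      _ = 108 * ℓ ^ 6 * exp (-(δ * ℓ)) := by ring
      _ ≤ exp (δ * ℓ) * exp (-(δ * ℓ)) := by gcongr
      _ = 1 := by rw [← exp_add]; simp
  · have h1 : (1 - 2 * δ) / (a * ℓ) ≤ (1 - δ) / ((1 + δ) * a * ℓ) := by
      rw [div_le_div_iff₀ (by positivity) hb0]
      have : (1 - 2 * δ) * (1 + δ) ≤ 1 - δ := by nlinarith
      calc _ = (1 - 2 * δ) * (1 + δ) * (a * ℓ) := by ring
        _ ≤ _ := by gcongr
    have h2 : (1 - δ) / ((1 + δ) * a * ℓ) * k ≤ m * (r + 1) := by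
      calc _ = m * (((1 - δ) * (k / m)) / ((1 + δ) * a * ℓ)) := by field_simp
        _ ≤ m * (((c : ℝ) + 1) / ((1 + δ) * a * ℓ)) := by gcongr
        _ ≤ _ := by gcongr
    have h3 : (m : ℝ) ≤ 2 * δ / (a * ℓ) * k := by
      refine hm1.trans ?_
      rw [div_mul_eq_mul_div, div_le_div_iff₀ (by positivity) (by positivity)]
      calc (k : ℝ) * (a * ℓ) ≤ k * (2 * δ * ℓ * ℓ) := by gcongr
        _ = _ := by ring
    have h4 : (1 - 2 * δ) / (a * ℓ) * k ≤ m * (r + 1) :=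
      (mul_le_mul_of_nonneg_right h1 hk0.le).trans h2
    calc (1 - 4 * δ) * k / (a * ℓ)
        = (1 - 2 * δ) / (a * ℓ) * k - 2 * δ / (a * ℓ) * k := by ring
      _ ≤ m * (r + 1) - m := by linarith
      _ = m * r := by ring

/-- Main theorem: for every a ≥ 1 and ε > 0 there is k₀ such that for all k ≥ k₀,
every k-uniform hypergraph with maximum degree at most k^a admits an equitable strong
coloring with at least (1-ε)k/(a ln k) parts. -/
theorem stmt13 (a : ℝ) (ha : 1 ≤ a) (ε : ℝ) (hε : 0 < ε) :
    ∃ k0 : ℕ, ∀ k : ℕ, k ≥ k0 →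
      ∀ (V : Type) (_ : Fintype V) (_ : DecidableEq V) (H : Finset (Finset V)),
        (∀ e ∈ H, e.card = k) →
        (∀ v : V, ((H.filter (fun e => v ∈ e)).card : ℝ) ≤ (k : ℝ) ^ a) →
        ∃ r : ℕ, (1 - ε) * k / (a * Real.log k) ≤ (r : ℝ) ∧
          ∃ P : Fin r → Finset V, IsStrongColoring H r P ∧ IsEquitable r P := by
  obtain ⟨δ, hδ⟩ : ∃ δ, δ = min ε (1 / 2) / 4 := ⟨_, rfl⟩
  have hδ0 : 0 < δ := hδ ▸ by positivity
  have hδ1 : δ ≤ 1 / 8 := by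
    have := min_le_right ε (1 / 2)
    linarith
  have hδε : 4 * δ ≤ ε := by
    have := min_le_left ε (1 / 2)
    linarith
  have hη := add_one_sub_mul_log_one_sub_pos hδ0 (by linarith)
  obtain ⟨k0, hk0⟩ := Filter.eventually_atTop.1 (eventually_large_log δ
    (max 1 (max (a / (2 * δ)) ((a + 5) / (δ + (1 - δ) * log (1 - δ))))) hδ0)
  refine ⟨max k0 1, fun k hk V _ _ H hH hdeg => ?_⟩
  obtain ⟨hB, hℓ2, hℓ6⟩ := hk0 k (le_trans (le_max_left _ _) hk)
  have hk1 : 1 ≤ k := le_trans (le_max_right _ _) hk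
  have hk1' : (1 : ℝ) ≤ k := by exact_mod_cast hk1
  obtain ⟨hB1, hB2, hB3⟩ := by simpa only [max_le_iff] using hB
  rw [div_le_iff₀' (by positivity)] at hB2
  rw [div_le_iff₀' hη] at hB3
  obtain ⟨m, r, c, q, hm, hr, hq, hL, hL', hmr⟩ := exists_splitting_parameters ha hδ0 hδ1
    (exp_log (by linarith)) hB1 hB2 hB3 hℓ2 hℓ6
  have : NeZero m := ⟨hm.ne'⟩
  have : NeZero r := ⟨hr.ne'⟩
  refine ⟨m * r, ?_, exists_equitable_strongColoring_mul H k m r c hH hk1 _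
    (one_le_rpow hk1' (by linarith)) hdeg (1 - δ) q (by linarith) (by linarith)
    (by rwa [sub_sub_cancel]) hL hL'⟩
  push_cast
  refine le_trans ?_ hmr
  have : 0 ≤ a * log k := by nlinarith
  gcongr
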